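/- For every non-negative integer n, \(625 \sum_{k=0}^{n} \binom{2n}{n+k} F_{k}^{8} = 35 \cdot 4^{n} + 7^{2n} + 8(-1)^{n+1} \cdot 4^{2n} + 28 \cdot 3^{2n} + 56(-1)^{n+1}\). -/

import Mathlib

/-- The symmetric half of the binomial expansion of `((1 + x) ^ 2 / x) ^ n`, with `y = x⁻¹`. -/
theorem sum_choose_mul_pow_add_pow {R : Type*} [CommRing R] {x y : R} (h : x * y = 1) (n : ℕ) :
    ∑ k ∈ Finset.range (n + 1), ((2 * n).choose (n + k) : R) * (x ^ k + y ^ k) =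
      (x + y + 2) ^ n + ((2 * n).choose n : R) := by
  have hxy (m : ℕ) : x ^ m * y ^ m = 1 := by rw [← mul_pow, h, one_pow]
  have hpow : (x + y + 2) ^ n = y ^ n * (x + 1) ^ (2 * n) := by
    rw [pow_mul, ← mul_pow]
    congr 1
    linear_combination (-x - 2) * h
  have hupper (k : ℕ) : y ^ n * (x ^ (n + k) * ((2 * n).choose (n + k) : R)) =
      ((2 * n).choose (n + k) : R) * x ^ k := by
    rw [pow_add]
    linear_combination x ^ k * ((2 * n).choose (n + k) : R) * hxy n
  have hlower : ∀ k ∈ Finset.range (n + 1),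
      y ^ n * (x ^ (n - k) * ((2 * n).choose (n - k) : R)) =
        ((2 * n).choose (n + k) : R) * y ^ k := by
    intro k hk
    have hk : k ≤ n := by simpa [Nat.lt_succ_iff] using hk
    rw [Nat.choose_symm_of_eq_add (show 2 * n = (n - k) + (n + k) by omega)]
    have hy : y ^ n = y ^ (n - k) * y ^ k := by rw [← pow_add, Nat.sub_add_cancel hk]
    rw [hy]
    linear_combination y ^ k * ((2 * n).choose (n + k) : R) * hxy (n - k)
  have hreflect := Finset.sum_range_reflect
    (fun j ↦ y ^ n * (x ^ j * ((2 * n).choose j : R))) (n + 1)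
  simp only [Nat.add_sub_cancel] at hreflect
  rw [Finset.sum_congr rfl hlower,
    Finset.sum_range_succ (fun j ↦ y ^ n * (x ^ j * ((2 * n).choose j : R)))] at hreflect
  have hmid := hupper 0
  simp only [add_zero, pow_zero, mul_one] at hmid
  rw [hpow, add_pow]
  simp only [one_pow, mul_one, mul_add, Finset.sum_add_distrib]
  rw [show 2 * n + 1 = n + (n + 1) by ring,
    Finset.sum_range_add (fun j ↦ x ^ j * ((2 * n).choose j : R)), mul_add, Finset.mul_sum,
    Finset.mul_sum, Finset.sum_congr rfl fun k _ ↦ hupper k]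
  linear_combination hreflect + hmid

/-- The eighth power of Binet's formula, expanded with `φ * ψ = -1`. -/
theorem fib_pow_eight_eq (k : ℕ) :
    625 * (Nat.fib k : ℝ) ^ 8 =
      ((Real.goldenRatio ^ 8) ^ k + (Real.goldenConj ^ 8) ^ k)
      - 8 * ((-Real.goldenRatio ^ 6) ^ k + (-Real.goldenConj ^ 6) ^ k)
      + 28 * ((Real.goldenRatio ^ 4) ^ k + (Real.goldenConj ^ 4) ^ k)
      - 56 * ((-Real.goldenRatio ^ 2) ^ k + (-Real.goldenConj ^ 2) ^ k)
      + 35 * (1 ^ k + 1 ^ k) := by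
  have h5 : (√5 : ℝ) ^ 8 = 625 := by
    rw [show (8 : ℕ) = 2 * 4 by rfl, pow_mul, Real.sq_sqrt (by norm_num)]
    norm_num
  have hprod : Real.goldenRatio ^ k * Real.goldenConj ^ k = (-1) ^ k := by
    rw [← mul_pow, Real.goldenRatio_mul_goldenConj]
  have hsign : ((-1 : ℝ) ^ k) ^ 2 = 1 := by rw [← pow_mul, mul_comm, pow_mul]; norm_num
  rw [Real.coe_fib_eq, div_pow, h5, neg_pow (Real.goldenRatio ^ 6),
    neg_pow (Real.goldenConj ^ 6), neg_pow (Real.goldenRatio ^ 2), neg_pow (Real.goldenConj ^ 2)]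
  simp only [← pow_mul, mul_comm _ k, one_pow]
  simp only [pow_mul]
  generalize Real.goldenRatio ^ k = a at *
  generalize Real.goldenConj ^ k = b at *
  generalize (-1 : ℝ) ^ k = s at *
  subst hprod
  linear_combination
    (28 * (a ^ 4 + b ^ 4) - 56 * (a * b) * (a ^ 2 + b ^ 2) + 70 * ((a * b) ^ 2 + 1)) * hsign

/-- For every non-negative integer `n`,
`625 ∑_{k=0}^n C(2n, n+k) F_k⁸
  = 35·4^n + 7^{2n} + 8(-1)^{n+1}·4^{2n} + 28·3^{2n} + 56(-1)^{n+1}` (as integers). -/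
theorem sum_choose_fib_eighth (n : ℕ) :
    625 * ∑ k ∈ Finset.range (n + 1),
        ((Nat.choose (2 * n) (n + k) : ℤ) * (Nat.fib k : ℤ) ^ 8) =
      35 * 4 ^ n + 7 ^ (2 * n) + 8 * (-1) ^ (n + 1) * 4 ^ (2 * n) +
        28 * 3 ^ (2 * n) + 56 * (-1) ^ (n + 1) := by
  have hsq := Real.goldenRatio_sq
  have hsq' := Real.goldenConj_sq
  have hadd := Real.goldenRatio_add_goldenConj
  have hmul := Real.goldenRatio_mul_goldenConj
  have hinv (m : ℕ) : Real.goldenRatio ^ m * Real.goldenConj ^ m = (-1) ^ m := by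
    rw [← mul_pow, hmul]
  have hpow2 : Real.goldenRatio ^ 2 + Real.goldenConj ^ 2 = 3 := by
    linear_combination hsq + hsq' + hadd
  have hpow4 : Real.goldenRatio ^ 4 + Real.goldenConj ^ 4 = 7 := by
    linear_combination (Real.goldenRatio ^ 2 + Real.goldenConj ^ 2 + 3) * hpow2 - 2 * hinv 2
  have hpow6 : Real.goldenRatio ^ 6 + Real.goldenConj ^ 6 = 18 := by
    linear_combination (Real.goldenRatio ^ 4 + Real.goldenConj ^ 4) * hpow2 + 3 * hpow4 -
      (Real.goldenRatio ^ 2 + Real.goldenConj ^ 2) * hinv 2 - hpow2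
  have hpow8 : Real.goldenRatio ^ 8 + Real.goldenConj ^ 8 = 47 := by
    linear_combination (Real.goldenRatio ^ 4 + Real.goldenConj ^ 4 + 7) * hpow4 - 2 * hinv 4
  have h8 := sum_choose_mul_pow_add_pow (x := Real.goldenRatio ^ 8) (y := Real.goldenConj ^ 8)
    (by linear_combination hinv 8) n
  have h6 := sum_choose_mul_pow_add_pow (x := -Real.goldenRatio ^ 6) (y := -Real.goldenConj ^ 6)
    (by linear_combination hinv 6) n
  have h4 := sum_choose_mul_pow_add_pow (x := Real.goldenRatio ^ 4) (y := Real.goldenConj ^ 4)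
    (by linear_combination hinv 4) n
  have h2 := sum_choose_mul_pow_add_pow (x := -Real.goldenRatio ^ 2) (y := -Real.goldenConj ^ 2)
    (by linear_combination hinv 2) n
  have h0 := sum_choose_mul_pow_add_pow (x := (1 : ℝ)) (y := 1) (by norm_num) n
  rw [show Real.goldenRatio ^ 8 + Real.goldenConj ^ 8 + 2 = 7 ^ 2 by
    linear_combination hpow8, ← pow_mul] at h8
  rw [show -Real.goldenRatio ^ 6 + -Real.goldenConj ^ 6 + 2 = -1 * 4 ^ 2 by
    linear_combination -hpow6, mul_pow, ← pow_mul] at h6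
  rw [show Real.goldenRatio ^ 4 + Real.goldenConj ^ 4 + 2 = 3 ^ 2 by
    linear_combination hpow4, ← pow_mul] at h4
  rw [show -Real.goldenRatio ^ 2 + -Real.goldenConj ^ 2 + 2 = -1 by
    linear_combination -hpow2] at h2
  rw [show (1 : ℝ) + 1 + 2 = 4 by norm_num] at h0
  rify
  have hsum : 625 * ∑ k ∈ Finset.range (n + 1),
      ((2 * n).choose (n + k) : ℝ) * (Nat.fib k : ℝ) ^ 8 =
      ∑ k ∈ Finset.range (n + 1), ((2 * n).choose (n + k) : ℝ) *
        (625 * (Nat.fib k : ℝ) ^ 8) := by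
    rw [Finset.mul_sum]
    exact Finset.sum_congr rfl fun k _ ↦ by ring
  simp only [fib_pow_eight_eq, mul_add, mul_sub, mul_left_comm _ (8 : ℝ),
    mul_left_comm _ (28 : ℝ), mul_left_comm _ (56 : ℝ), mul_left_comm _ (35 : ℝ),
    Finset.sum_add_distrib, Finset.sum_sub_distrib, ← Finset.mul_sum] at hsum h8 h6 h4 h2 h0
  rw [pow_succ]
  linear_combination hsum + h8 - 8 * h6 + 28 * h4 - 56 * h2 + 35 * h0
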